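/- Let p be a prime, n an even positive integer, s a positive integer with s ≤ n/2, and F : V_n → V_s a function. Fix ε ∈ {1,−1}, with ε = 1 if p = 2. Then the following are equivalent. (1) F is a vectorial dual-bent function satisfying Condition A with sign ε. (2) There exist pairwise disjoint sets W_i ⊆ V_n (i ∈ V_s) with ⋃_{i ∈ V_s} W_i = V_n such that for every nonempty subset I ⊆ V_s and every u ∈ V_n, ∑_{x ∈ F⁻¹(I)} ζ_p^{⟨u,x⟩} = p^{n−s}·|I|·[u = 0] + ε·p^{n/2−s}·(p^s·[u ∈ ⋃_{i∈I} W_i] − |I|), where [·] is 1 if the stated condition holds and 0 otherwise. -/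

import Mathlib

open Finset

/-- `ζ_p^t = exp(2πi·t.val/p)` for `t : ZMod p`. -/
noncomputable def zetaP (p : ℕ) (t : ZMod p) : ℂ :=
  Complex.exp (2 * Real.pi * Complex.I * (t.val : ℂ) / (p : ℂ))

/-- The standard inner product on `V_n = Fin n → ZMod p`. -/
def ip {p n : ℕ} (a x : Fin n → ZMod p) : ZMod p := ∑ i, a i * x i

/-- The Walsh transform of `f : V_n → ZMod p`. -/
noncomputable def walsh {p n : ℕ} [NeZero p] (f : (Fin n → ZMod p) → ZMod p)
    (a : Fin n → ZMod p) : ℂ :=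
  ∑ x : Fin n → ZMod p, zetaP p (f x - ip a x)

/-- `F : V_n → V_s` is a vectorial dual-bent function satisfying Condition A with sign `ε`:
there is a vectorial dual `F*` such that every nonzero component function `F_c` has Walsh
transform `ε·p^(n/2)·ζ_p^(⟨c,F*(a)⟩)`. -/
def ConditionA {n s : ℕ} (p : ℕ) [NeZero p]
    (F : (Fin n → ZMod p) → (Fin s → ZMod p)) (ε : ℤ) : Prop :=
  ∃ Fd : (Fin n → ZMod p) → (Fin s → ZMod p),
    ∀ c : Fin s → ZMod p, c ≠ 0 → ∀ a : Fin n → ZMod p,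
      walsh (fun x => ip c (F x)) a = (ε : ℂ) * (p : ℂ) ^ (n / 2) * zetaP p (ip c (Fd a))

section WalshTransform

variable {p n s : ℕ}

theorem ip_comm (a x : Fin n → ZMod p) : ip a x = ip x a := by
  simp [ip, mul_comm]

theorem ip_add (a x y : Fin n → ZMod p) : ip a (x + y) = ip a x + ip a y := by
  simp [ip, mul_add, Finset.sum_add_distrib]

theorem ip_zero (a : Fin n → ZMod p) : ip a 0 = 0 := by
  simp [ip]

theorem zero_ip (a : Fin n → ZMod p) : ip 0 a = 0 := by
  simp [ip]

theorem ip_sub (a x y : Fin n → ZMod p) : ip a (x - y) = ip a x - ip a y := by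
  simp [ip, mul_sub, Finset.sum_sub_distrib]

theorem neg_ip (a x : Fin n → ZMod p) : ip (-a) x = -ip a x := by
  simp [ip]

variable [Fact p.Prime]

theorem zetaP_eq_stdAddChar (t : ZMod p) : zetaP p t = ZMod.stdAddChar t := by
  rw [ZMod.stdAddChar_apply, ZMod.toCircle_apply, zetaP]

theorem zetaP_add (a b : ZMod p) : zetaP p (a + b) = zetaP p a * zetaP p b := by
  simp only [zetaP_eq_stdAddChar, AddChar.map_add_eq_mul]

theorem zetaP_zero : zetaP p 0 = 1 := by
  simp [zetaP_eq_stdAddChar]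

/-- The additive character `x ↦ ζ_p^⟨c,x⟩` of `V_n`. -/
noncomputable def ipAddChar (c : Fin n → ZMod p) : AddChar (Fin n → ZMod p) ℂ where
  toFun x := zetaP p (ip c x)
  map_zero_eq_one' := by rw [ip_zero, zetaP_zero]
  map_add_eq_mul' x y := by rw [ip_add, zetaP_add]

theorem ipAddChar_eq_zero_iff (c : Fin n → ZMod p) : ipAddChar c = 0 ↔ c = 0 := by
  constructor
  · intro h
    ext j
    have hj : zetaP p (ip c (Pi.single j 1)) = 1 := DFunLike.congr_fun h (Pi.single j 1)
    rw [zetaP_eq_stdAddChar, ← AddChar.map_zero_eq_one (ZMod.stdAddChar (N := p))] at hj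
    simpa [ip, Pi.single_apply] using ZMod.injective_stdAddChar hj
  · rintro rfl
    ext x
    change zetaP p (ip 0 x) = 1
    rw [zero_ip, zetaP_zero]

theorem sum_zetaP_ip (c : Fin n → ZMod p) :
    ∑ x, zetaP p (ip c x) = if c = 0 then (p : ℂ) ^ n else 0 := by
  classical
  have h := AddChar.sum_eq_ite (ipAddChar c)
  simp only [ipAddChar_eq_zero_iff] at h
  simpa [ipAddChar] using h

theorem sum_zetaP_ip_sub (a b : Fin n → ZMod p) :
    ∑ c, zetaP p (ip c a - ip c b) = if a = b then (p : ℂ) ^ n else 0 := by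
  simp only [← ip_sub, ip_comm _ (a - b), sum_zetaP_ip, sub_eq_zero]

theorem pow_mul_sum_fiber (F : (Fin n → ZMod p) → (Fin s → ZMod p)) (i : Fin s → ZMod p)
    (u : Fin n → ZMod p) :
    (p : ℂ) ^ s * ∑ x with F x = i, zetaP p (ip u x) =
      ∑ c, walsh (fun x => ip c (F x)) (-u) * zetaP p (-ip c i) := by
  simp only [walsh, Finset.sum_mul, ← zetaP_add]
  rw [Finset.sum_comm, Finset.sum_filter, Finset.mul_sum]
  refine Finset.sum_congr rfl fun x _ => ?_
  have h : ∀ c, zetaP p (ip c (F x) - ip (-u) x + -ip c i) =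
      zetaP p (ip c (F x) - ip c i) * zetaP p (ip u x) := fun c => by
    rw [← zetaP_add, neg_ip]
    congr 1
    ring
  simp only [h, ← Finset.sum_mul, sum_zetaP_ip_sub]
  split_ifs <;> simp

theorem walsh_eq_sum_fiber (F : (Fin n → ZMod p) → (Fin s → ZMod p)) (c : Fin s → ZMod p)
    (a : Fin n → ZMod p) :
    walsh (fun x => ip c (F x)) a =
      ∑ i, zetaP p (ip c i) * ∑ x with F x = i, zetaP p (ip (-a) x) := by
  rw [walsh, ← Finset.sum_fiberwise Finset.univ F]
  refine Finset.sum_congr rfl fun i _ => ?_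
  rw [Finset.mul_sum]
  refine Finset.sum_congr rfl fun x hx => ?_
  rw [← zetaP_add, (Finset.mem_filter.1 hx).2, neg_ip, sub_eq_add_neg]

theorem walsh_zero (a : Fin n → ZMod p) :
    walsh (fun _ => 0) a = if a = 0 then (p : ℂ) ^ n else 0 := by
  simp only [walsh, zero_sub, ← neg_ip, sum_zetaP_ip, neg_eq_zero]

/-- A function `Fd` is a vectorial dual of `F` for Condition A if and only if the character sums
over the fibres of `F` are governed by the fibres of `Fd`. -/
theorem walsh_eq_iff_sum_fiber (hsn : s ≤ n / 2)
    (F : (Fin n → ZMod p) → (Fin s → ZMod p)) (Fd : (Fin n → ZMod p) → (Fin s → ZMod p)) (ε : ℂ) :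
    (∀ c, c ≠ 0 → ∀ a, walsh (fun x => ip c (F x)) a =
        ε * (p : ℂ) ^ (n / 2) * zetaP p (ip c (Fd a))) ↔
      ∀ i u, ∑ x with F x = i, zetaP p (ip u x) =
        (p : ℂ) ^ (n - s) * (if u = 0 then 1 else 0) +
          ε * (p : ℂ) ^ (n / 2 - s) * ((p : ℂ) ^ s * (if Fd (-u) = i then 1 else 0) - 1) := by
  have hp : (p : ℂ) ^ s ≠ 0 := pow_ne_zero _ (Nat.cast_ne_zero.2 (Fact.out : p.Prime).ne_zero)
  have h₁ : (p : ℂ) ^ n = (p : ℂ) ^ s * (p : ℂ) ^ (n - s) := by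
    rw [← pow_add]; congr 1; omega
  have h₂ : (p : ℂ) ^ (n / 2) = (p : ℂ) ^ s * (p : ℂ) ^ (n / 2 - s) := by
    rw [← pow_add]; congr 1; omega
  constructor
  · intro h i u
    apply mul_left_cancel₀ hp
    have hc : ∀ c, walsh (fun x => ip c (F x)) (-u) * zetaP p (-ip c i) =
        ε * (p : ℂ) ^ (n / 2) * zetaP p (ip c (Fd (-u)) - ip c i) +
          if c = 0 then (if u = 0 then (p : ℂ) ^ n else 0) - ε * (p : ℂ) ^ (n / 2) else 0 := by
      intro c
      split_ifs with hc hu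
      · simp [hc, hu, zero_ip, walsh_zero, zetaP_zero]
      · simp [hc, hu, zero_ip, walsh_zero, zetaP_zero]
      · rw [h c hc, sub_eq_add_neg, zetaP_add]
        ring
    rw [pow_mul_sum_fiber, Finset.sum_congr rfl fun c _ => hc c, Finset.sum_add_distrib,
      ← Finset.mul_sum, sum_zetaP_ip_sub, Finset.sum_ite_eq', if_pos (Finset.mem_univ _), h₁, h₂]
    split_ifs <;> ring
  · intro h c hc a
    have hi : ∀ i, zetaP p (ip c i) * ∑ x with F x = i, zetaP p (ip (-a) x) =
        ((p : ℂ) ^ (n - s) * (if -a = 0 then 1 else 0) - ε * (p : ℂ) ^ (n / 2 - s)) *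
            zetaP p (ip c i) +
          if Fd a = i then ε * (p : ℂ) ^ (n / 2) * zetaP p (ip c i) else 0 := by
      intro i
      rw [h, neg_neg, h₂]
      split_ifs <;> ring
    rw [walsh_eq_sum_fiber, Finset.sum_congr rfl fun i _ => hi i, Finset.sum_add_distrib,
      ← Finset.mul_sum, sum_zetaP_ip, if_neg hc, Finset.sum_ite_eq, if_pos (Finset.mem_univ _)]
    ring

end WalshTransform

open scoped Classical in
theorem stmt0 (p : ℕ) [Fact p.Prime] (n s : ℕ) (hn : 0 < n) (hneven : Even n)
    (hs : 0 < s) (hsn : s ≤ n / 2)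
    (F : (Fin n → ZMod p) → (Fin s → ZMod p)) (ε : ℤ)
    (hε : ε = 1 ∨ ε = -1) (hε2 : p = 2 → ε = 1) :
    ConditionA p F ε ↔
      ∃ W : (Fin s → ZMod p) → Set (Fin n → ZMod p),
        (Set.univ : Set (Fin s → ZMod p)).PairwiseDisjoint W ∧
        (⋃ i, W i) = Set.univ ∧
        ∀ I : Finset (Fin s → ZMod p), I.Nonempty → ∀ u : Fin n → ZMod p,
          ∑ x ∈ Finset.univ.filter (fun x => F x ∈ I), zetaP p (ip u x) =
            (p : ℂ) ^ (n - s) * (I.card : ℂ) * (if u = 0 then 1 else 0) +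
              (ε : ℂ) * (p : ℂ) ^ (n / 2 - s) *
                ((p : ℂ) ^ s * (if u ∈ ⋃ i ∈ (I : Set (Fin s → ZMod p)), W i then 1 else 0)
                  - (I.card : ℂ)) := by
  constructor
  · rintro ⟨Fd, hFd⟩
    have h := (walsh_eq_iff_sum_fiber hsn F Fd ε).1 hFd
    refine ⟨fun i => {u | Fd (-u) = i}, ?_, ?_, fun I _ u => ?_⟩
    · intro i _ j _ hij
      exact Set.disjoint_left.2 fun u hi hj => hij (hi.symm.trans hj)
    · ext u
      simp
    · rw [← Finset.sum_fiberwise_of_maps_to (t := I) (g := F) (by simp)]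
      have hi : ∀ i ∈ I, ∑ x ∈ Finset.univ.filter (fun x => F x ∈ I) with F x = i,
          zetaP p (ip u x) =
          (p : ℂ) ^ (n - s) * (if u = 0 then 1 else 0) +
            (ε : ℂ) * (p : ℂ) ^ (n / 2 - s) *
              ((p : ℂ) ^ s * (if Fd (-u) = i then 1 else 0) - 1) := by
        intro i hi
        have hfilter : (Finset.univ.filter fun x => F x ∈ I).filter (fun x => F x = i) =
            Finset.univ.filter fun x => F x = i := by
          ext x
          simp only [Finset.mem_filter, Finset.mem_univ, true_and]
          exact ⟨And.right, fun hx => ⟨hx ▸ hi, hx⟩⟩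
        rw [hfilter]
        convert h i u
      rw [Finset.sum_congr rfl hi, Finset.sum_add_distrib, ← Finset.mul_sum, ← Finset.mul_sum,
        Finset.sum_sub_distrib, ← Finset.mul_sum, Finset.sum_ite_eq]
      simp only [Finset.sum_const, nsmul_eq_mul, mul_one, Set.mem_iUnion, Set.mem_ofPred_eq,
        Finset.mem_coe, exists_prop, exists_eq_right']
      ring
  · rintro ⟨W, hdisj, hcover, hW⟩
    choose idx hidx using fun u => Set.mem_iUnion.1 (hcover ▸ Set.mem_univ u : u ∈ ⋃ i, W i)
    have hmem : ∀ u i, u ∈ W i ↔ idx u = i := fun u i =>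
      ⟨fun hu => hdisj.elim_set (Set.mem_univ _) (Set.mem_univ _) u (hidx u) hu,
        fun hi => hi ▸ hidx u⟩
    refine ⟨fun a => idx (-a), (walsh_eq_iff_sum_fiber hsn F _ ε).2 fun i u => ?_⟩
    have h := hW {i} (Finset.singleton_nonempty i) u
    simp only [Finset.mem_singleton, Finset.card_singleton, Nat.cast_one, mul_one,
      Finset.coe_singleton, Set.biUnion_singleton, hmem] at h
    simp only [neg_neg]
    convert h
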